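/- Let T be a tree containing three vertices v₁, w, x such that v₁ is adjacent to w, w is adjacent to x, the degrees in T satisfy deg(v₁) = 2, deg(w) = 2, and deg(x) = 1. Then γ_e(T) ≤ γ_e(T − {v₁, w, x}) + 1, where T − {v₁, w, x} is the tree obtained from T by deleting the vertices v₁, w, x. -/

import Mathlib

open SimpleGraph

/-- The contribution `(1/2)^(d-1)` of a vertex at `S`-restricted distance `d`,
with `(1/2)^∞ = 0`. -/
noncomputable def expStep (d : ℕ∞) : ℝ :=
  if h : d = ⊤ then 0 else (1 / 2 : ℝ) ^ ((d.untop h : ℤ) - 1)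

/-- `expDist G S u v` is the minimum number of edges of a walk in `G` from `u` to `v`
such that `v` is the only vertex of the walk belonging to `S` (i.e. the distance from `u`
to `v ∈ S` in `G - (S \ {v})`), and `⊤` if no such walk exists. -/
noncomputable def expDist {V : Type*} (G : SimpleGraph V) (S : Finset V) (u v : V) : ℕ∞ :=
  sInf {n : ℕ∞ | ∃ p : G.Walk u v, (∀ x ∈ p.support, x ∈ S → x = v) ∧ (p.length : ℕ∞) = n}

/-- The weight `w_{(G,S)}(u) = Σ_{v ∈ S} (1/2)^(dist_{(G,S)}(u,v) - 1)`. -/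
noncomputable def expWeight {V : Type*} (G : SimpleGraph V) (S : Finset V) (u : V) : ℝ :=
  ∑ v ∈ S, expStep (expDist G S u v)

/-- `S` is an exponential dominating set of `G`. -/
def IsExpDomSet {V : Type*} (G : SimpleGraph V) (S : Finset V) : Prop :=
  ∀ u : V, 1 ≤ expWeight G S u

/-- The exponential domination number of `G`. -/
noncomputable def expDomNum {V : Type*} (G : SimpleGraph V) : ℕ :=
  sInf {k : ℕ | ∃ S : Finset V, IsExpDomSet G S ∧ S.card = k}

theorem expStep_nonneg (d : ℕ∞) : 0 ≤ expStep d := by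
  unfold expStep
  split_ifs <;> positivity

theorem expStep_antitone : Antitone expStep := by
  intro a b hab
  by_cases hb : b = ⊤
  · simpa [expStep, hb] using expStep_nonneg a
  · have ha : a ≠ ⊤ := ne_top_of_le_ne_top hb hab
    lift a to ℕ using ha
    lift b to ℕ using hb
    have hab' : a ≤ b := by exact_mod_cast hab
    simp only [expStep, ENat.natCast_ne_top, dite_false]
    refine zpow_le_zpow_right_of_le_one₀ (by norm_num) (by norm_num) ?_
    change (a : ℤ) - 1 ≤ (b : ℤ) - 1
    omega

theorem one_le_expStep {d : ℕ∞} (hd : d ≤ 1) : 1 ≤ expStep d := by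
  have h : expStep 1 = 1 := by
    have h1 : (1 : ℕ∞) ≠ ⊤ := by simp
    rw [expStep, dif_neg h1]
    change (1 / 2 : ℝ) ^ (((1 : ℕ) : ℤ) - 1) = 1
    norm_num
  exact h ▸ expStep_antitone hd

theorem expDist_le_length {V : Type*} {G : SimpleGraph V} {S : Finset V} {u v : V}
    (p : G.Walk u v) (hp : ∀ x ∈ p.support, x ∈ S → x = v) : expDist G S u v ≤ p.length :=
  sInf_le ⟨p, hp, rfl⟩

theorem expDist_self {V : Type*} (G : SimpleGraph V) (S : Finset V) (u : V) :
    expDist G S u u = 0 :=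
  le_antisymm (expDist_le_length (Walk.nil : G.Walk u u) (by simp)) bot_le

theorem expDist_le_one {V : Type*} {G : SimpleGraph V} {S : Finset V} {u v : V}
    (h : G.Adj u v) (hu : u ∉ S) : expDist G S u v ≤ 1 := by
  refine (expDist_le_length h.toWalk ?_).trans (by simp)
  intro x hx hxS
  have hx' : x = u ∨ x = v := by simpa using hx
  rcases hx' with rfl | rfl
  · exact absurd hxS hu
  · rfl

theorem one_le_expWeight {V : Type*} {G : SimpleGraph V} {S : Finset V} {u v : V}
    (hv : v ∈ S) (h : expDist G S u v ≤ 1) : 1 ≤ expWeight G S u :=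
  (one_le_expStep h).trans
    (Finset.single_le_sum (f := fun v => expStep (expDist G S u v))
      (fun _ _ => expStep_nonneg _) hv)

theorem exists_isExpDomSet_card_eq_expDomNum {V : Type*} [Finite V] (G : SimpleGraph V) :
    ∃ S : Finset V, IsExpDomSet G S ∧ S.card = expDomNum G := by
  have := Fintype.ofFinite V
  exact Nat.sInf_mem (s := {k : ℕ | ∃ S : Finset V, IsExpDomSet G S ∧ S.card = k})
    ⟨_, Finset.univ, fun u => one_le_expWeight (Finset.mem_univ u) (by simp [expDist_self]), rfl⟩

/-- Vertices added outside an induced subgraph do not obstruct walks inside it. -/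
theorem expDist_insert_map_subtype_le {V : Type*} [DecidableEq V] (G : SimpleGraph V)
    {s : Set V} (S : Finset s) {w : V} (hw : w ∉ s) (u v : s) :
    expDist G (insert w (S.map (Function.Embedding.subtype (· ∈ s)))) u v ≤
      expDist (G.induce s) S u v := by
  refine le_sInf ?_
  rintro _ ⟨p, hp, rfl⟩
  refine (expDist_le_length (p.map (Embedding.induce s).toHom) ?_).trans
    (congrArg Nat.cast (Walk.length_map _ p)).le
  intro x hx hxS
  rw [Walk.support_map, List.mem_map] at hx
  obtain ⟨y, hy, rfl⟩ := hx
  rcases Finset.mem_insert.1 hxS with h | h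
  · exact absurd (h ▸ y.2) hw
  · obtain ⟨z, hz, hzy⟩ := Finset.mem_map.1 h
    obtain rfl : z = y := Subtype.ext hzy
    exact congrArg Subtype.val (hp z hy hz)

theorem expWeight_induce_le_insert {V : Type*} [DecidableEq V] (G : SimpleGraph V)
    {s : Set V} (S : Finset s) {w : V} (hw : w ∉ s) (u : s) :
    expWeight (G.induce s) S u ≤
      expWeight G (insert w (S.map (Function.Embedding.subtype (· ∈ s)))) u := by
  refine le_trans ?_ (Finset.sum_le_sum_of_subset_of_nonneg (Finset.subset_insert _ _)
    fun _ _ _ => expStep_nonneg _)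
  rw [Finset.sum_map]
  exact Finset.sum_le_sum fun v _ => expStep_antitone (expDist_insert_map_subtype_le G S hw u v)

/-- Lemma 7(ii): if a tree `T` contains vertices `v₁, w, x` with `v₁` adjacent to
`w`, `w` adjacent to `x`, `deg(v₁) = 2`, `deg(w) = 2` and `deg(x) = 1`, then
`γ_e(T) ≤ γ_e(T - {v₁, w, x}) + 1`. -/
theorem expDomNum_le_delete_pendant_path {V : Type*} [Fintype V] [DecidableEq V]
    (T : SimpleGraph V) [DecidableRel T.Adj] (hT : T.IsTree) (v₁ w x : V)
    (h1 : T.Adj v₁ w) (h2 : T.Adj w x)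
    (hd1 : T.degree v₁ = 2) (hdw : T.degree w = 2) (hdx : T.degree x = 1) :
    expDomNum T ≤ expDomNum (T.induce {y : V | y ≠ v₁ ∧ y ≠ w ∧ y ≠ x}) + 1 := by
  obtain ⟨S, hS, hcard⟩ := exists_isExpDomSet_card_eq_expDomNum
    (T.induce {y : V | y ≠ v₁ ∧ y ≠ w ∧ y ≠ x})
  have hw : w ∉ {y : V | y ≠ v₁ ∧ y ≠ w ∧ y ≠ x} := fun h => h.2.1 rfl
  set S' := insert w (S.map (Function.Embedding.subtype
    (· ∈ {y : V | y ≠ v₁ ∧ y ≠ w ∧ y ≠ x}))) with hS'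
  have hwS : w ∈ S' := Finset.mem_insert_self _ _
  have hv₁S : v₁ ∉ S' := by simp [hS', h1.ne]
  have hxS : x ∉ S' := by simp [hS', h2.ne']
  have hdom : IsExpDomSet T S' := by
    intro u
    by_cases hu : u ∈ {y : V | y ≠ v₁ ∧ y ≠ w ∧ y ≠ x}
    · exact (hS ⟨u, hu⟩).trans (expWeight_induce_le_insert T S hw ⟨u, hu⟩)
    · have hu' : u = v₁ ∨ u = w ∨ u = x := by
        by_contra! h
        exact hu h
      rcases hu' with rfl | rfl | rfl
      · exact one_le_expWeight hwS (expDist_le_one h1 hv₁S)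
      · exact one_le_expWeight hwS (by simp [expDist_self])
      · exact one_le_expWeight hwS (expDist_le_one h2.symm hxS)
  calc expDomNum T ≤ S'.card := Nat.sInf_le ⟨S', hdom, rfl⟩
    _ ≤ S.card + 1 := (Finset.card_insert_le _ _).trans (by rw [Finset.card_map])
    _ = _ := by rw [hcard]
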